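/- If N is an odd natural number, then (N² − 1)/2 is an eigenvalue of J_N: there exists a nonzero vector v : Fin N → ℝ with J_N.mulVec v = ((N² − 1)/2 : ℝ) • v. -/

import Mathlib

open Matrix

/-- The `N × N` symmetric Pascal matrix, `(T_N)_{jk} = C(j+k, j)`. -/
noncomputable def pascalT (N : ℕ) : Matrix (Fin N) (Fin N) ℝ :=
  fun j k => (Nat.choose (j.1 + k.1) j.1 : ℝ)

/-- The `N × N` lower-triangular Pascal matrix, `(Ψ_N)_{jk} = C(j, k)`. -/
noncomputable def psiMat (N : ℕ) : Matrix (Fin N) (Fin N) ℝ :=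
  fun j k => (Nat.choose j.1 k.1 : ℝ)

/-- The `N × N` diagonal sign matrix `Λ_N = diag(1, -1, 1, …)`. -/
noncomputable def lamMat (N : ℕ) : Matrix (Fin N) (Fin N) ℝ :=
  Matrix.diagonal fun j => (-1 : ℝ) ^ j.1

/-- The `N × N` symmetric tridiagonal (Jacobi) matrix `J_N` with diagonal entries
`(J_N)_{jj} = -N²·j + 2j³ + 3j² + 2j` and off-diagonal entries
`(J_N)_{j,j+1} = (J_N)_{j+1,j} = (j+1)·(N² - (j+1)²)`. -/
noncomputable def jacobiJ (N : ℕ) : Matrix (Fin N) (Fin N) ℝ :=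
  fun j k =>
    if j.1 = k.1 then
      -((N : ℝ) ^ 2) * (j.1 : ℝ) + 2 * (j.1 : ℝ) ^ 3 + 3 * (j.1 : ℝ) ^ 2 + 2 * (j.1 : ℝ)
    else if j.1 + 1 = k.1 then (k.1 : ℝ) * ((N : ℝ) ^ 2 - (k.1 : ℝ) ^ 2)
    else if k.1 + 1 = j.1 then (j.1 : ℝ) * ((N : ℝ) ^ 2 - (j.1 : ℝ) ^ 2)
    else 0

/-- The off-diagonal entries vanish past both ends of the matrix, so multiplication by `J_N` is
given by one three-term formula, valid in every row. -/
lemma sum_jacobiJ_mul (N : ℕ) (f : ℕ → ℝ) (j : Fin N) :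
    ∑ m : Fin N, jacobiJ N j m * f m =
      (-((N : ℝ) ^ 2) * j + 2 * (j : ℝ) ^ 3 + 3 * (j : ℝ) ^ 2 + 2 * j) * f j
        + j * ((N : ℝ) ^ 2 - (j : ℝ) ^ 2) * f (j - 1)
        + (j + 1) * ((N : ℝ) ^ 2 - ((j : ℝ) + 1) ^ 2) * f (j + 1) := by
  obtain ⟨j, hj⟩ := j
  have split_entry : ∀ m : Fin N, jacobiJ N ⟨j, hj⟩ m * f m =
      (if j = m.1 then
        (-((N : ℝ) ^ 2) * j + 2 * (j : ℝ) ^ 3 + 3 * (j : ℝ) ^ 2 + 2 * j) * f j else 0)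
      + (if j - 1 = m.1 then j * ((N : ℝ) ^ 2 - (j : ℝ) ^ 2) * f (j - 1) else 0)
      + (if j + 1 = m.1 then
        (j + 1) * ((N : ℝ) ^ 2 - ((j : ℝ) + 1) ^ 2) * f (j + 1) else 0) := by
    rintro ⟨m, hm⟩
    rcases Nat.eq_zero_or_pos j with rfl | hpos
    · by_cases h₀ : 0 = m
      · subst h₀; simp [jacobiJ]
      · by_cases h₁ : 1 = m
        · subst h₁; simp [jacobiJ]
        · simp [jacobiJ, h₀, h₁]
    · by_cases h₀ : j = m
      · subst h₀
        simp [jacobiJ, show j - 1 ≠ j by omega]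
      · by_cases h₁ : j + 1 = m
        · subst h₁
          simp [jacobiJ, show j - 1 ≠ j + 1 by omega]
        · by_cases h₂ : m + 1 = j
          · subst h₂
            simp [jacobiJ, show m + 1 + 1 ≠ m by omega]
          · simp [jacobiJ, h₀, h₁, h₂, show j - 1 ≠ m by omega]
  simp_rw [split_entry, Finset.sum_add_distrib]
  rw [Fin.sum_univ_eq_sum_range (fun m => if j = m then
        (-((N : ℝ) ^ 2) * j + 2 * (j : ℝ) ^ 3 + 3 * (j : ℝ) ^ 2 + 2 * j) * f j else 0),
    Fin.sum_univ_eq_sum_range (fun m => if j - 1 = m then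
        j * ((N : ℝ) ^ 2 - (j : ℝ) ^ 2) * f (j - 1) else 0),
    Fin.sum_univ_eq_sum_range (fun m => if j + 1 = m then
        (j + 1) * ((N : ℝ) ^ 2 - ((j : ℝ) + 1) ^ 2) * f (j + 1) else 0)]
  simp only [Finset.sum_ite_eq, Finset.mem_range, hj, show j - 1 < N by omega, if_true]
  by_cases h : j + 1 < N
  · simp [h]
  · have hN : N = j + 1 := by omega
    simp [hN]

lemma jacobiJ_symm (N : ℕ) (j k : Fin N) : jacobiJ N j k = jacobiJ N k j := by
  unfold jacobiJ
  split_ifs <;> first | omega | simp_all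

/-- The three-term relation between binomial coefficients behind the reflection symmetry of
`J_N`. -/
lemma choose_three_term (x : ℝ) (j k : ℕ) :
    (-x * j + 2 * (j : ℝ) ^ 3 + 3 * (j : ℝ) ^ 2 + 2 * j) * (j.choose k : ℝ)
        + j * (x - (j : ℝ) ^ 2) * ((j - 1).choose k : ℝ)
        + (j + 1) * (x - ((j : ℝ) + 1) ^ 2) * ((j + 1).choose k : ℝ) =
      (x - 1) * (j.choose k : ℝ)
        - (-x * k + 2 * (k : ℝ) ^ 3 + 3 * (k : ℝ) ^ 2 + 2 * k) * (j.choose k : ℝ)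
        + k * (x - (k : ℝ) ^ 2) * (j.choose (k - 1) : ℝ)
        + (k + 1) * (x - ((k : ℝ) + 1) ^ 2) * (j.choose (k + 1) : ℝ) := by
  have choose_succ_right : ∀ i : ℕ,
      ((i : ℝ) + 1) * (j.choose (i + 1) : ℝ) = (j - i) * (j.choose i : ℝ) := by
    intro i
    rcases le_or_gt i j with h | h
    · have := Nat.choose_succ_right_eq j i
      have h' : (j.choose (i + 1) : ℝ) * (i + 1) = j.choose i * ((j - i : ℕ) : ℝ) := by
        exact_mod_cast this
      rw [Nat.cast_sub h] at h'
      linear_combination h'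
    · simp [Nat.choose_eq_zero_of_lt h, Nat.choose_eq_zero_of_lt (h.trans (Nat.lt_succ_self i))]
  have choose_pred_left : (j : ℝ) * ((j - 1).choose k : ℝ) = (j - k) * (j.choose k : ℝ) := by
    rcases j with _ | n
    · rcases k with _ | k <;> simp
    · have h : ((n : ℝ) + 1) * n.choose k = (n + 1).choose (k + 1) * (k + 1) := by
        exact_mod_cast Nat.add_one_mul_choose_eq n k
      have h' := choose_succ_right k
      push_cast at h' ⊢
      linear_combination h + h'
  have hk := choose_succ_right k
  rcases k with _ | k
  · simp only [Nat.choose_zero_right, Nat.cast_zero, Nat.cast_one] at *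
    linear_combination (x - (j : ℝ) ^ 2) * choose_pred_left - (x - 1) * hk
  · have hd := choose_succ_right k
    rw [Nat.choose_succ_succ' j k]
    push_cast at *
    linear_combination (x - (j : ℝ) ^ 2) * choose_pred_left - (x - ((k : ℝ) + 1 + 1) ^ 2) * hk
      - (x - ((j : ℝ) + 1) ^ 2 - ((j : ℝ) + 1) * (k + 1) - ((k : ℝ) + 1) ^ 2) * hd

/-- Conjugation by `Ψ_N Λ_N` reflects `J_N` about `(N² - 1)/2`. -/
lemma jacobiJ_mul_psiMat_mul_lamMat (N : ℕ) :
    jacobiJ N * (psiMat N * lamMat N) =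
      psiMat N * lamMat N * (((N : ℝ) ^ 2 - 1) • 1 - jacobiJ N) := by
  ext j k
  have hl := sum_jacobiJ_mul N (fun m => (m.choose k : ℝ) * (-1) ^ k.1) j
  have hr := sum_jacobiJ_mul N (fun m => (j.1.choose m : ℝ) * (-1) ^ m) k
  have entry : ∀ a b, (psiMat N * lamMat N) a b = (a.1.choose b : ℝ) * (-1) ^ b.1 := by
    intro a b
    simp [lamMat, psiMat, Matrix.mul_diagonal]
  rw [Matrix.mul_sub, Matrix.mul_smul, Matrix.mul_one, Matrix.sub_apply, Matrix.smul_apply,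
    Matrix.mul_apply, Matrix.mul_apply (N := jacobiJ N)]
  simp only [entry, smul_eq_mul]
  have hcol : ∀ m, (j.1.choose m.1 : ℝ) * (-1) ^ m.1 * jacobiJ N m k =
      jacobiJ N k m * ((j.1.choose m.1 : ℝ) * (-1) ^ m.1) := by
    intro m
    rw [jacobiJ_symm N m k, mul_comm]
  rw [hl, Finset.sum_congr rfl fun m _ => hcol m, hr]
  have h := choose_three_term ((N : ℝ) ^ 2) j k
  have hsign : (k : ℝ) * (-1 : ℝ) ^ (k.1 - 1) = -(k * (-1) ^ k.1) := by
    rcases k.1 with _ | i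
    · simp
    · simp [pow_succ]
  rw [pow_succ]
  linear_combination (-1 : ℝ) ^ k.1 * h
    + ((N : ℝ) ^ 2 - (k : ℝ) ^ 2) * (j.1.choose (k.1 - 1) : ℝ) * hsign

lemma det_psiMat (N : ℕ) : (psiMat N).det = 1 := by
  rw [Matrix.det_of_isLowerTriangular]
  · simp [psiMat]
  · intro i j hij
    simpa [psiMat] using Nat.choose_eq_zero_of_lt (by simpa using hij)

lemma det_lamMat_ne_zero (N : ℕ) : (lamMat N).det ≠ 0 := by
  simp [lamMat, Matrix.det_diagonal, Finset.prod_ne_zero_iff]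

/-- If `A` is similar to `-A` and has odd size, then it is singular. -/
lemma det_eq_zero_of_mul_eq_mul_neg {N : ℕ} (hN : Odd N) {A P : Matrix (Fin N) (Fin N) ℝ}
    (hP : P.det ≠ 0) (h : A * P = P * -A) : A.det = 0 := by
  have hdet := congrArg Matrix.det h
  rw [Matrix.det_mul, Matrix.det_mul, Matrix.det_neg, Fintype.card_fin, hN.neg_one_pow] at hdet
  have : P.det * A.det = 0 := by linarith
  exact (mul_eq_zero.mp this).resolve_left hP

/-- If `N` is odd, then `(N² - 1)/2` is an eigenvalue of `J_N`. -/
theorem jacobi_middle_eigenvalue (N : ℕ) (hN : Odd N) :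
    ∃ v : Fin N → ℝ, v ≠ 0 ∧
      (jacobiJ N).mulVec v = (((N : ℝ) ^ 2 - 1) / 2) • v := by
  set c : ℝ := ((N : ℝ) ^ 2 - 1) / 2 with hc
  have hP : (psiMat N * lamMat N).det ≠ 0 := by
    rw [Matrix.det_mul, det_psiMat, one_mul]
    exact det_lamMat_ne_zero N
  have hA : (jacobiJ N - c • 1).det = 0 := by
    refine det_eq_zero_of_mul_eq_mul_neg hN hP ?_
    have h2 : ((N : ℝ) ^ 2 - 1) = c + c := by rw [hc]; ring
    rw [Matrix.sub_mul, jacobiJ_mul_psiMat_mul_lamMat, h2, add_smul]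
    simp only [Matrix.mul_sub, Matrix.mul_add, Matrix.mul_neg, Matrix.smul_mul, Matrix.mul_smul,
      Matrix.one_mul, Matrix.mul_one]
    abel
  obtain ⟨v, hv, h⟩ := Matrix.exists_mulVec_eq_zero_iff.mpr hA
  refine ⟨v, hv, ?_⟩
  rwa [Matrix.sub_mulVec, Matrix.smul_mulVec, Matrix.one_mulVec, sub_eq_zero] at h
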